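/- Let p ≥ 1, n ≥ 1, let a₁, …, a_p ∈ ℝⁿ, let b₁, …, b_p ∈ {−1, 1} with b_i = 1 for some index i and b_j = −1 for some index j, and let μ > 0. Define F: ℝⁿ × ℝ → ℝ by F(w, v) = Σ_{i=1}^p log(1 + exp(−b_i(⟨a_i, w⟩ + v))) + μ Σ_{l=1}^n |w_l|^{1/2}. Then F is level-bounded: for every α ∈ ℝ the sublevel set {(w, v) ∈ ℝⁿ × ℝ : F(w, v) ≤ α} is bounded. -/

import Mathlib

open Filter Topology
open scoped RealInnerProductSpace

noncomputable section

/-- `ℝⁿ` with the Euclidean norm. -/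
abbrev E (n : ℕ) : Type := EuclideanSpace ℝ (Fin n)

lemma le_log_one_add_exp (t : ℝ) : t ≤ Real.log (1 + Real.exp t) := by
  rw [Real.le_log_iff_exp_le (by positivity)]
  linarith

lemma log_one_add_exp_nonneg (t : ℝ) : 0 ≤ Real.log (1 + Real.exp t) :=
  Real.log_nonneg (by linarith [Real.exp_pos t])

lemma norm_le_sqrt_sum_of_abs_le {n : ℕ} {w : E n} {C : ℝ}
    (h : ∀ l, |w l| ≤ C) : ‖w‖ ≤ √(∑ _l : Fin n, C ^ 2) := by
  rw [EuclideanSpace.norm_eq]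
  gcongr with l
  exact h l

/-- level-boundedness of the `ℓ_{1/2}`-regularized logistic regression
objective.  If the labels `b_i ∈ {−1, 1}` take both values and `μ > 0`, then every
sublevel set of
`F(w, v) = Σᵢ log(1 + exp(−bᵢ(⟨aᵢ, w⟩ + v))) + μ Σₗ |wₗ|^{1/2}` is bounded. -/
theorem logistic_lq_level_bounded
    {p n : ℕ} (hp : 1 ≤ p) (hn : 1 ≤ n)
    (a : Fin p → E n) (b : Fin p → ℝ)
    (hb : ∀ i, b i = 1 ∨ b i = -1)
    (hb_one : ∃ i, b i = 1) (hb_negone : ∃ j, b j = -1)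
    (μ : ℝ) (hμ : 0 < μ)
    (F : E n × ℝ → ℝ)
    (hF : ∀ (w : E n) (v : ℝ),
      F (w, v) = (∑ i : Fin p, Real.log (1 + Real.exp (- b i * (⟪a i, w⟫ + v))))
        + μ * ∑ l : Fin n, |w l| ^ ((1 : ℝ) / 2)) :
    ∀ α : ℝ, Bornology.IsBounded {wv : E n × ℝ | F wv ≤ α} := by
  intro α
  obtain ⟨i, hi⟩ := hb_one
  obtain ⟨j, hj⟩ := hb_negone
  set R : ℝ := √(∑ _l : Fin n, ((α / μ) ^ 2) ^ 2)
  set S : ℝ := α + (‖a i‖ + ‖a j‖) * R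
  refine (Metric.isBounded_closedBall (x := (0 : E n × ℝ)) (r := max R S)).subset ?_
  rintro ⟨w, v⟩ hwv
  rw [Set.mem_ofPred_eq, hF] at hwv
  have hlog_nonneg : ∀ k ∈ Finset.univ,
      0 ≤ Real.log (1 + Real.exp (-b k * (⟪a k, w⟫ + v))) :=
    fun k _ => log_one_add_exp_nonneg _
  have hpow_nonneg : ∀ l ∈ Finset.univ, 0 ≤ |w l| ^ ((1 : ℝ) / 2) :=
    fun l _ => by positivity
  have hmargin (k : Fin p) : -b k * (⟪a k, w⟫ + v) ≤ α := by
    have hk := Finset.single_le_sum hlog_nonneg (Finset.mem_univ k)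
    have hreg := mul_nonneg hμ.le (Finset.sum_nonneg hpow_nonneg)
    linarith [le_log_one_add_exp (-b k * (⟪a k, w⟫ + v))]
  have hcoord (l : Fin n) : |w l| ≤ (α / μ) ^ 2 := by
    have hl : |w l| ^ ((1 : ℝ) / 2) ≤ α / μ := by
      refine (Finset.single_le_sum hpow_nonneg (Finset.mem_univ l)).trans ?_
      rw [le_div_iff₀' hμ]
      linarith [Finset.sum_nonneg hlog_nonneg]
    rw [← Real.sqrt_eq_rpow] at hl
    exact (Real.sqrt_le_iff.mp hl).2
  have hw : ‖w‖ ≤ R := norm_le_sqrt_sum_of_abs_le hcoord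
  have hinner (k : Fin p) : |⟪a k, w⟫| ≤ ‖a k‖ * R :=
    (abs_real_inner_le_norm _ _).trans (by gcongr)
  have hv : |v| ≤ S := by
    have hposi := hmargin i
    have hnegj := hmargin j
    rw [hi] at hposi
    rw [hj] at hnegj
    have hnonneg (k : Fin p) : 0 ≤ ‖a k‖ * R := (abs_nonneg _).trans (hinner k)
    rw [abs_le]
    constructor <;>
      linarith [hnonneg i, hnonneg j,
        (abs_le.mp (hinner i)).2, (abs_le.mp (hinner j)).1,
        add_mul ‖a i‖ ‖a j‖ R]
  rw [mem_closedBall_zero_iff, Prod.norm_mk, Real.norm_eq_abs]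
  exact max_le_max hw hv
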